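/- Constant cumulative posterior standard deviation under a Matérn-type information-gain bound, case d < ν: assume k(x, x) ≤ 1 for all x ∈ X, that the Matérn-type information-gain hypothesis holds, and that d < ν. Then for every T ∈ ℕ₊ and every sequence x₁, …, x_T ∈ X, ∑_{t=1}^T σ(x_t; X_{t−1}) ≤ T̄_Mat + C̃_Mat^{1/2} · Γ(ν/d + 1) / (ν/d − 1)^{ν/d + 1}, where Γ denotes the Euler Gamma function. -/

import Mathlib

open Matrix

noncomputable section

/-- Gram matrix `K = [k(x_i, x_j)]` of the kernel `k` on the finite family `xs`. -/
def gram {X ι : Type*} [Fintype ι] (k : X → X → ℝ) (xs : ι → X) :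
    Matrix ι ι ℝ := fun i j => k (xs i) (xs j)

/-- Kernel vector `k_t(x) = (k(x₁, x), …, k(x_t, x))`. -/
def kvec {X ι : Type*} [Fintype ι] (k : X → X → ℝ) (xs : ι → X) (x : X) :
    ι → ℝ := fun i => k (xs i) x

/-- Regularized posterior variance `σ²_{λ²}(x; xs) = k(x,x) - k_t(x)ᵀ (K + λ² I)⁻¹ k_t(x)`.
For the empty family this is `k(x,x)`. -/
def postVar {X ι : Type*} [Fintype ι] [DecidableEq ι] (k : X → X → ℝ)
    (xs : ι → X) (lam : ℝ) (x : X) : ℝ :=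
  k x x - kvec k xs x ⬝ᵥ ((gram k xs + lam ^ 2 • (1 : Matrix ι ι ℝ))⁻¹ *ᵥ kvec k xs x)

/-- Noise-free posterior standard deviation `σ(x; xs) = inf_{λ > 0} σ_{λ²}(x; xs)`. -/
def postStd {X ι : Type*} [Fintype ι] [DecidableEq ι] (k : X → X → ℝ)
    (xs : ι → X) (x : X) : ℝ :=
  ⨅ lam : {l : ℝ // 0 < l}, Real.sqrt (postVar k xs lam.1 x)

/-- Maximum information gain `γ_T(λ²) = sup_{x₁,…,x_T} (1/2) ln det (I_T + λ⁻² K_T)`,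
a value in `[0, ∞]`. -/
def mig {X : Type*} (k : X → X → ℝ) (T : ℕ) (lam : ℝ) : ENNReal :=
  ⨆ xs : Fin T → X, ENNReal.ofReal
    ((1 / 2) * Real.log ((1 + (lam ^ 2)⁻¹ • gram k xs).det))

/-- The prefix `X_{t-1} = (x₁, …, x_{t-1})` of a finite sequence (`t` is 0-indexed). -/
def pre {X : Type*} {T : ℕ} (xs : Fin T → X) (t : Fin T) : Fin t.1 → X :=
  fun i => xs ⟨i.1, i.2.trans t.2⟩

/-- Noise-free posterior mean `μ(x; xs) = k_t(x)ᵀ K⁻¹ (f(x₁), …, f(x_t))ᵀ`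
(for the empty family this is `0`). -/
def postMean {X ι : Type*} [Fintype ι] [DecidableEq ι] (k : X → X → ℝ)
    (xs : ι → X) (f : X → ℝ) (x : X) : ℝ :=
  kvec k xs x ⬝ᵥ ((gram k xs)⁻¹ *ᵥ fun i => f (xs i))

/-- Noise-free posterior standard deviation in closed form,
`σ(x; xs) = (k(x,x) - k_t(x)ᵀ K⁻¹ k_t(x))^{1/2}` (for the empty family, `k(x,x)^{1/2}`). -/
def postStdInv {X ι : Type*} [Fintype ι] [DecidableEq ι] (k : X → X → ℝ)
    (xs : ι → X) (x : X) : ℝ :=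
  Real.sqrt (k x x - kvec k xs x ⬝ᵥ ((gram k xs)⁻¹ *ᵥ kvec k xs x))

/-- The first `t` points `X_t = (x₁, …, x_t)` of an infinite sequence. -/
def prefN {X : Type*} (xseq : ℕ → X) (t : ℕ) : Fin t → X := fun i => xseq i

section Posterior

variable {X : Type*} {k : X → X → ℝ}

/-- The regularized Gram matrix of a positive-semidefinite kernel is positive definite. -/
lemma posDef_gram_add (hsym : ∀ x y : X, k x y = k y x)
    (hpsd : ∀ (n : ℕ) (xv : Fin n → X) (c : Fin n → ℝ),
      0 ≤ ∑ i, ∑ j, c i * c j * k (xv i) (xv j))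
    {n : ℕ} (xs : Fin n → X) {lam : ℝ} (hlam : 0 < lam) :
    (gram k xs + lam ^ 2 • (1 : Matrix (Fin n) (Fin n) ℝ)).PosDef := by
  have hK : (gram k xs).PosSemidef := by
    refine .of_dotProduct_mulVec_nonneg ?_ fun c => ?_
    · ext i j
      simp [_root_.gram, hsym (xs j) (xs i)]
    · have h := hpsd n xs c
      simpa [dotProduct, mulVec, _root_.gram, Finset.mul_sum, mul_assoc, mul_left_comm, mul_comm] using h
  exact Matrix.PosDef.posSemidef_add hK (PosDef.one.smul (by positivity))

/-- Error of the linear predictor with weights `c`, including the ridge penalty. -/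
def ridgeError {ι : Type*} [Fintype ι] [DecidableEq ι] (k : X → X → ℝ) (xs : ι → X)
    (lam : ℝ) (x : X) (c : ι → ℝ) : ℝ :=
  k x x - 2 * (c ⬝ᵥ kvec k xs x) +
    c ⬝ᵥ ((gram k xs + lam ^ 2 • (1 : Matrix ι ι ℝ)) *ᵥ c)

/-- Completing the square in the ridge error. -/
lemma ridgeError_eq (hsym : ∀ x y : X, k x y = k y x)
    (hpsd : ∀ (n : ℕ) (xv : Fin n → X) (c : Fin n → ℝ),
      0 ≤ ∑ i, ∑ j, c i * c j * k (xv i) (xv j))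
    {n : ℕ} (xs : Fin n → X) {lam : ℝ} (hlam : 0 < lam) (x : X) (c : Fin n → ℝ) :
    ridgeError k xs lam x c = postVar k xs lam x +
      (c - (gram k xs + lam ^ 2 • (1 : Matrix (Fin n) (Fin n) ℝ))⁻¹ *ᵥ kvec k xs x) ⬝ᵥ
        ((gram k xs + lam ^ 2 • (1 : Matrix (Fin n) (Fin n) ℝ)) *ᵥ
          (c - (gram k xs + lam ^ 2 • (1 : Matrix (Fin n) (Fin n) ℝ))⁻¹ *ᵥ kvec k xs x)) := by
  have hM := posDef_gram_add hsym hpsd xs hlam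
  unfold ridgeError postVar
  set M := gram k xs + lam ^ 2 • (1 : Matrix (Fin n) (Fin n) ℝ) with hMdef
  set v := kvec k xs x
  have hMt : Mᵀ = M := by simpa using hM.1.eq
  have hinv : M *ᵥ (M⁻¹ *ᵥ v) = v := by
    rw [mulVec_mulVec, Matrix.mul_nonsing_inv _ ((isUnit_iff_isUnit_det _).1 hM.isUnit),
      one_mulVec]
  have hcross : (M⁻¹ *ᵥ v) ⬝ᵥ (M *ᵥ c) = c ⬝ᵥ v := by
    rw [dotProduct_mulVec, ← mulVec_transpose, hMt, hinv, dotProduct_comm]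
  rw [mulVec_sub, hinv, sub_dotProduct, dotProduct_sub, dotProduct_sub, hcross,
    dotProduct_comm (M⁻¹ *ᵥ v) v]
  ring

/-- The posterior variance is the minimal ridge error. -/
lemma postVar_le_ridgeError (hsym : ∀ x y : X, k x y = k y x)
    (hpsd : ∀ (n : ℕ) (xv : Fin n → X) (c : Fin n → ℝ),
      0 ≤ ∑ i, ∑ j, c i * c j * k (xv i) (xv j))
    {n : ℕ} (xs : Fin n → X) {lam : ℝ} (hlam : 0 < lam) (x : X) (c : Fin n → ℝ) :
    postVar k xs lam x ≤ ridgeError k xs lam x c := by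
  rw [ridgeError_eq hsym hpsd xs hlam]
  have h := (posDef_gram_add hsym hpsd xs hlam).posSemidef.dotProduct_mulVec_nonneg
    (c - (gram k xs + lam ^ 2 • (1 : Matrix (Fin n) (Fin n) ℝ))⁻¹ *ᵥ kvec k xs x)
  exact le_add_of_nonneg_right (by simpa only [star_trivial] using h)

/-- The posterior variance does not increase when observations are added. -/
lemma postVar_le_postVar_comp (hsym : ∀ x y : X, k x y = k y x)
    (hpsd : ∀ (n : ℕ) (xv : Fin n → X) (c : Fin n → ℝ),
      0 ≤ ∑ i, ∑ j, c i * c j * k (xv i) (xv j))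
    {m n : ℕ} (xs : Fin n → X) {f : Fin m → Fin n} (hf : Function.Injective f)
    {lam : ℝ} (hlam : 0 < lam) (x : X) :
    postVar k xs lam x ≤ postVar k (xs ∘ f) lam x := by
  set c : Fin m → ℝ := (gram k (xs ∘ f) + lam ^ 2 • (1 : Matrix (Fin m) (Fin m) ℝ))⁻¹ *ᵥ
    kvec k (xs ∘ f) x with hc
  have hmin : ridgeError k (xs ∘ f) lam x c = postVar k (xs ∘ f) lam x := by
    rw [ridgeError_eq hsym hpsd _ hlam, ← hc]
    simp
  let c' : Fin n → ℝ := fun j => ∑ i, if f i = j then c i else 0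
  have hsum : ∀ g : Fin n → ℝ, ∑ j, c' j * g j = ∑ i, c i * g (f i) := by
    intro g
    simp only [c', Finset.sum_mul]
    rw [Finset.sum_comm]
    simp
  have hcf : ∀ i, c' (f i) = c i := by
    intro i
    simp [c', hf.eq_iff]
  have hext : ridgeError k xs lam x c' = ridgeError k (xs ∘ f) lam x c := by
    unfold ridgeError
    simp only [add_mulVec, dotProduct_add, smul_mulVec, one_mulVec, dotProduct_smul]
    simp only [dotProduct, mulVec, hsum, hcf]
    have : ∀ i, ∑ j, gram k xs (f i) j * c' j = ∑ j, gram k (xs ∘ f) i j * c j := by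
      intro i
      simp only [mul_comm _ (c' _), hsum]
      simp [_root_.gram, mul_comm]
    simp only [this]
    simp [kvec]
  rw [← hmin, ← hext]
  exact postVar_le_ridgeError hsym hpsd xs hlam x c'

/-- Adding a point multiplies the regularized Gram determinant by `λ² + σ²`. -/
lemma det_gram_succ (hsym : ∀ x y : X, k x y = k y x)
    (hpsd : ∀ (n : ℕ) (xv : Fin n → X) (c : Fin n → ℝ),
      0 ≤ ∑ i, ∑ j, c i * c j * k (xv i) (xv j))
    {n : ℕ} (ys : Fin (n + 1) → X) {lam : ℝ} (hlam : 0 < lam) :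
    (gram k ys + lam ^ 2 • (1 : Matrix (Fin (n + 1)) (Fin (n + 1)) ℝ)).det =
      (gram k (ys ∘ Fin.castSucc) + lam ^ 2 • (1 : Matrix (Fin n) (Fin n) ℝ)).det *
        (lam ^ 2 + postVar k (ys ∘ Fin.castSucc) lam (ys (Fin.last n))) := by
  have hM := posDef_gram_add hsym hpsd (ys ∘ Fin.castSucc) hlam
  unfold postVar
  set M := gram k (ys ∘ Fin.castSucc) + lam ^ 2 • (1 : Matrix (Fin n) (Fin n) ℝ) with hMdef
  set v := kvec k (ys ∘ Fin.castSucc) (ys (Fin.last n)) with hv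
  let _ : Invertible M := hM.isUnit.invertible
  have hblock : (gram k ys + lam ^ 2 • (1 : Matrix (Fin (n + 1)) (Fin (n + 1)) ℝ)).submatrix
      (finSumFinEquiv (m := n) (n := 1)) (finSumFinEquiv (m := n) (n := 1)) =
      fromBlocks M (of fun i _ => v i) (of fun _ i => v i)
        (of fun _ _ => k (ys (Fin.last n)) (ys (Fin.last n)) + lam ^ 2) := by
    ext (i | i) (j | j)
    · have hij : (Fin.castAdd 1 i = Fin.castAdd 1 j) ↔ i = j := by
        simp [Fin.ext_iff]
      simp only [submatrix_apply, finSumFinEquiv_apply_left, fromBlocks_apply₁₁, hMdef, Matrix.add_apply,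
        Matrix.smul_apply, one_apply, hij]
      rfl
    · have hj : Fin.natAdd n j = Fin.last n := by ext; simp
      have hij : Fin.castAdd 1 i ≠ Fin.last n := (Fin.castSucc_lt_last i).ne
      simp only [submatrix_apply, finSumFinEquiv_apply_left, finSumFinEquiv_apply_right, hj,
        fromBlocks_apply₁₂, Matrix.add_apply, Matrix.smul_apply, one_apply, hij]
      simp [_root_.gram, hv, kvec]
      rfl
    · have hi : Fin.natAdd n i = Fin.last n := by ext; simp
      have hij : Fin.last n ≠ Fin.castAdd 1 j := (Fin.castSucc_lt_last j).ne'
      simp only [submatrix_apply, finSumFinEquiv_apply_left, finSumFinEquiv_apply_right, hi,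
        fromBlocks_apply₂₁, Matrix.add_apply, Matrix.smul_apply, one_apply, hij]
      simp [_root_.gram, hv, kvec]
      exact hsym _ _
    · have h : ∀ j : Fin 1, Fin.natAdd n j = Fin.last n := fun j => by ext; simp
      simp [_root_.gram, h]
  rw [← det_submatrix_equiv_self (finSumFinEquiv (m := n) (n := 1)), hblock, det_fromBlocks₁₁,
    invOf_eq_nonsing_inv]
  congr 1
  rw [det_fin_one, dotProduct_mulVec]
  simp only [Matrix.sub_apply, of_apply, Matrix.mul_apply, dotProduct, vecMul]
  ring

/-- If each point has posterior variance at least `λ²` given its predecessors, then the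
regularized Gram determinant is at least `(2λ²)ⁿ`. -/
lemma pow_le_det_gram (hsym : ∀ x y : X, k x y = k y x)
    (hpsd : ∀ (n : ℕ) (xv : Fin n → X) (c : Fin n → ℝ),
      0 ≤ ∑ i, ∑ j, c i * c j * k (xv i) (xv j))
    {lam : ℝ} (hlam : 0 < lam) {n : ℕ} (ys : Fin n → X)
    (h : ∀ i, lam ^ 2 ≤ postVar k (pre ys i) lam (ys i)) :
    (2 * lam ^ 2) ^ n ≤ (gram k ys + lam ^ 2 • (1 : Matrix (Fin n) (Fin n) ℝ)).det := by
  induction n with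
  | zero => simp
  | succ n ih =>
    rw [det_gram_succ hsym hpsd ys hlam, pow_succ]
    have h1 := ih (ys ∘ Fin.castSucc) fun i => h i.castSucc
    have h2 : lam ^ 2 ≤ postVar k (ys ∘ Fin.castSucc) lam (ys (Fin.last n)) := h (Fin.last n)
    exact mul_le_mul h1 (by linarith) (by positivity) (le_trans (by positivity) h1)

/-- If each point has posterior variance at least `λ²` given its predecessors, the maximum
information gain is at least `(n / 2) ln 2`. -/
lemma le_mig (hsym : ∀ x y : X, k x y = k y x)
    (hpsd : ∀ (n : ℕ) (xv : Fin n → X) (c : Fin n → ℝ),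
      0 ≤ ∑ i, ∑ j, c i * c j * k (xv i) (xv j))
    {lam : ℝ} (hlam : 0 < lam) {n : ℕ} (ys : Fin n → X)
    (h : ∀ i, lam ^ 2 ≤ postVar k (pre ys i) lam (ys i)) :
    ENNReal.ofReal (n / 2 * Real.log 2) ≤ mig k n lam := by
  refine le_trans (ENNReal.ofReal_le_ofReal ?_) (le_iSup (fun xs : Fin n → X => ENNReal.ofReal
    ((1 / 2) * Real.log ((1 + (lam ^ 2)⁻¹ • gram k xs).det))) ys)
  have hdet : (2 : ℝ) ^ n ≤ (1 + (lam ^ 2)⁻¹ • gram k ys).det := by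
    have heq : 1 + (lam ^ 2)⁻¹ • gram k ys =
        (lam ^ 2)⁻¹ • (gram k ys + lam ^ 2 • (1 : Matrix (Fin n) (Fin n) ℝ)) := by
      rw [smul_add, smul_smul, inv_mul_cancel₀ (by positivity), one_smul, add_comm]
    rw [heq, det_smul, Fintype.card_fin]
    calc (2 : ℝ) ^ n = ((lam ^ 2)⁻¹) ^ n * (2 * lam ^ 2) ^ n := by
          rw [← mul_pow]
          congr 1
          field_simp
      _ ≤ _ := by
          gcongr
          exact pow_le_det_gram hsym hpsd hlam ys h
  have hlog := Real.log_le_log (by positivity) hdet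
  rw [Real.log_pow] at hlog
  linarith

/-- The noise-free posterior standard deviation is at most each regularized one. -/
lemma postStd_le_sqrt_postVar {ι : Type*} [Fintype ι] [DecidableEq ι] (xs : ι → X) (x : X)
    {lam : ℝ} (hlam : 0 < lam) : postStd k xs x ≤ Real.sqrt (postVar k xs lam x) :=
  ciInf_le ⟨0, by rintro _ ⟨l, rfl⟩; exact Real.sqrt_nonneg _⟩ (⟨lam, hlam⟩ : {l : ℝ // 0 < l})

/-- The noise-free posterior standard deviation is at most one for a kernel bounded by one. -/
lemma postStd_le_one (hsym : ∀ x y : X, k x y = k y x)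
    (hpsd : ∀ (n : ℕ) (xv : Fin n → X) (c : Fin n → ℝ),
      0 ≤ ∑ i, ∑ j, c i * c j * k (xv i) (xv j))
    (hk1 : ∀ x : X, k x x ≤ 1) {n : ℕ} (xs : Fin n → X) (x : X) : postStd k xs x ≤ 1 := by
  refine (postStd_le_sqrt_postVar xs x one_pos).trans (Real.sqrt_le_one.2 ?_)
  have h := postVar_le_ridgeError hsym hpsd xs one_pos x 0
  have hx := hk1 x
  simp only [ridgeError, zero_dotProduct] at h
  linarith

/-- If the information gain of `#S` points at level `λ` is below `(#S / 2) ln 2`, then some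
index in `S` has posterior standard deviation at most `λ`. -/
lemma exists_postStd_le (hsym : ∀ x y : X, k x y = k y x)
    (hpsd : ∀ (n : ℕ) (xv : Fin n → X) (c : Fin n → ℝ),
      0 ≤ ∑ i, ∑ j, c i * c j * k (xv i) (xv j))
    {T : ℕ} (xs : Fin T → X) (S : Finset (Fin T)) {lam : ℝ} (hlam : 0 < lam)
    (hgain : mig k S.card lam < ENNReal.ofReal (S.card / 2 * Real.log 2)) :
    ∃ t ∈ S, postStd k (pre xs t) (xs t) ≤ lam := by
  by_contra! hlt
  refine hgain.not_ge ?_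
  set e := S.orderEmbOfFin rfl
  refine le_mig hsym hpsd hlam (xs ∘ e) fun i => ?_
  have h1 : lam < Real.sqrt (postVar k (pre xs (e i)) lam (xs (e i))) :=
    (hlt _ (S.orderEmbOfFin_mem rfl i)).trans_le (postStd_le_sqrt_postVar _ _ hlam)
  refine ((Real.lt_sqrt hlam.le).1 h1).le.trans ?_
  let f : Fin i.1 → Fin (e i).1 := fun j =>
    ⟨(e ⟨j.1, j.2.trans i.2⟩).1, e.strictMono (show (⟨j.1, j.2.trans i.2⟩ : Fin _) < i from j.2)⟩
  have hf : Function.Injective f := by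
    intro a b hab
    have hval : (f a).1 = (f b).1 := congrArg Fin.val hab
    exact Fin.ext (Fin.mk.inj (e.injective (Fin.ext hval)))
  exact postVar_le_postVar_comp hsym hpsd (pre xs (e i)) hf hlam (xs (e i))

end Posterior

/-- If every nonempty finite set of `m` indices contains one with `s ≤ g m`, then a sum of
`s` over `n` indices is at most `g 1 + ⋯ + g n`. -/
lemma sum_le_sum_range_of_exists_le {ι : Type*} (s : ι → ℝ) (g : ℕ → ℝ)
    (h : ∀ S : Finset ι, S.Nonempty → ∃ t ∈ S, s t ≤ g S.card) (S : Finset ι) :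
    ∑ t ∈ S, s t ≤ ∑ i ∈ Finset.range S.card, g (i + 1) := by
  classical
  induction hn : S.card generalizing S with
  | zero => simp [Finset.card_eq_zero.1 hn]
  | succ n ih =>
    obtain ⟨t, ht, hle⟩ := h S (Finset.card_pos.1 (by omega))
    rw [Finset.sum_range_succ, ← Finset.sum_erase_add S s ht]
    rw [hn] at hle
    exact add_le_add (ih (S.erase t) (by rw [Finset.card_erase_of_mem ht]; omega)) hle

/-- The integral of `(ln x / x) ^ p` over a subinterval of `[1, ∞)` is at most its Gamma-function
value over `[1, ∞)`. -/
lemma integral_log_div_self_rpow_le {p a b : ℝ} (hp : 1 < p) (ha : 1 ≤ a) (hab : a ≤ b) :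
    ∫ x in a..b, (Real.log x / x) ^ p ≤ Real.Gamma (p + 1) / (p - 1) ^ (p + 1) := by
  have ha0 : 0 < a := by linarith
  have hb0 : 0 < b := by linarith
  have hr : 0 < p - 1 := by linarith
  have key := Real.integral_rpow_mul_exp_neg_mul_Ioi (a := p + 1) (by linarith) hr
  have hGamma : 0 < Real.Gamma (p + 1) := Real.Gamma_pos_of_pos (by linarith)
  have hint : MeasureTheory.IntegrableOn
      (fun u : ℝ => u ^ (p + 1 - 1) * Real.exp (-((p - 1) * u))) (Set.Ioi 0) :=
    .of_integral_ne_zero (by rw [key]; positivity)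
  have hlog : Real.log a ≤ Real.log b := Real.log_le_log ha0 hab
  have hlog0 : 0 ≤ Real.log a := Real.log_nonneg ha
  have hcont : ContinuousOn (fun x : ℝ => (Real.log x / x) ^ p) (Set.Ioi 0) := by
    refine ContinuousOn.rpow_const ?_ fun _ _ => Or.inr (by linarith)
    refine (Real.continuousOn_log.mono fun x hx => ?_).div continuousOn_id fun x hx => ?_
    · exact (ne_of_gt hx : x ≠ 0)
    · exact (ne_of_gt hx : x ≠ 0)
  have hsubst := intervalIntegral.integral_comp_mul_deriv'' (a := Real.log a) (b := Real.log b)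
    (f := Real.exp) (f' := Real.exp) (g := fun x => (Real.log x / x) ^ p)
    Real.continuous_exp.continuousOn (fun x _ => (Real.hasDerivAt_exp x).hasDerivWithinAt)
    Real.continuous_exp.continuousOn
    (hcont.mono (by rintro _ ⟨x, _, rfl⟩; exact Real.exp_pos x))
  rw [Real.exp_log ha0, Real.exp_log hb0] at hsubst
  rw [← hsubst, intervalIntegral.integral_of_le hlog]
  calc ∫ u in Set.Ioc (Real.log a) (Real.log b),
        ((fun x => (Real.log x / x) ^ p) ∘ Real.exp) u * Real.exp u
      = ∫ u in Set.Ioc (Real.log a) (Real.log b),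
          u ^ (p + 1 - 1) * Real.exp (-((p - 1) * u)) := by
        refine MeasureTheory.setIntegral_congr_fun measurableSet_Ioc fun u hu => ?_
        have hu0 : 0 ≤ u := hlog0.trans hu.1.le
        simp only [Function.comp, Real.log_exp, add_sub_cancel_right]
        rw [Real.div_rpow hu0 (Real.exp_pos u).le, ← Real.exp_mul, div_mul_eq_mul_div,
          mul_div_assoc, ← Real.exp_sub]
        ring_nf
    _ ≤ ∫ u in Set.Ioi 0, u ^ (p + 1 - 1) * Real.exp (-((p - 1) * u)) := by
        refine MeasureTheory.setIntegral_mono_set hint ?_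
          (Filter.Eventually.of_forall fun u hu => lt_of_le_of_lt hlog0 hu.1)
        filter_upwards [MeasureTheory.ae_restrict_mem measurableSet_Ioi] with u hu
        have : (0 : ℝ) < u := hu
        simp only [Pi.zero_apply]
        positivity
    _ = _ := by
        rw [key, Real.div_rpow zero_le_one hr.le, Real.one_rpow]
        ring

/-- Sums of `(ln m / m) ^ p` over integers `m > N ≥ 3` are bounded by a Gamma-function value. -/
lemma sum_log_div_self_rpow_le {p : ℝ} (hp : 1 < p) {N : ℕ} (hN : 3 ≤ N) (n : ℕ) :
    ∑ i ∈ Finset.range n, (Real.log ((N + (i + 1) : ℕ) : ℝ) / ((N + (i + 1) : ℕ) : ℝ)) ^ p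
      ≤ Real.Gamma (p + 1) / (p - 1) ^ (p + 1) := by
  have hN' : (3 : ℝ) ≤ N := by exact_mod_cast hN
  have hanti : AntitoneOn (fun x : ℝ => (Real.log x / x) ^ p) (Set.Icc (N : ℝ) (N + n)) := by
    intro x hx y hy hxy
    have hx3 : 3 ≤ x := hN'.trans hx.1
    have hy3 : 3 ≤ y := hN'.trans hy.1
    have he := Real.exp_one_lt_three
    refine Real.rpow_le_rpow (div_nonneg (Real.log_nonneg (by linarith)) (by linarith)) ?_
      (by linarith)
    exact Real.log_div_self_antitoneOn (show Real.exp 1 ≤ x by linarith)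
      (show Real.exp 1 ≤ y by linarith) hxy
  refine le_trans (le_of_eq ?_) (hanti.sum_le_integral.trans
    (integral_log_div_self_rpow_le hp (by linarith) (by linarith [n.cast_nonneg (α := ℝ)])))
  push_cast
  rfl

/-- The Matérn-type information-gain bound is at most `t / 6` at `λ² = C̃ (ln t)ᵃ / tᵃ`. -/
lemma matern_gain_le {C Ct a t L : ℝ} (hC : 0 < C) (ha : 0 < a) (ht : 3 ≤ t) (hCt1 : 1 ≤ Ct)
    (hCt : (2 + a) ^ a * (6 * C) ^ (1 + a) ≤ Ct)
    (hL : L = Ct * t ^ (-a) * Real.log t ^ a) (hL1 : L ≤ 1) :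
    C * (t / L) ^ (1 / (1 + a)) * Real.log (t / L) ^ (a / (1 + a)) ≤ t / 6 := by
  have ht0 : 0 < t := by linarith
  have hlog1 : 1 ≤ Real.log t := by
    rw [Real.le_log_iff_exp_le ht0]
    linarith [Real.exp_one_lt_three]
  have hlog0 : 0 < Real.log t := by linarith
  have hCt0 : 0 < Ct := by linarith
  have hta : 0 < t ^ a := Real.rpow_pos_of_pos ht0 a
  have hlga : 0 < Real.log t ^ a := Real.rpow_pos_of_pos hlog0 a
  have hL' : L = Ct * Real.log t ^ a / t ^ a := by
    rw [hL, Real.rpow_neg ht0.le]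
    ring
  have hL0 : 0 < L := by
    rw [hL']
    positivity
  have hlogL0 : 0 ≤ Real.log (t / L) :=
    Real.log_nonneg (by rw [le_div_iff₀ hL0]; linarith)
  have hlogL : Real.log (t / L) ≤ (2 + a) * Real.log t := by
    have h1 : t / L ≤ t ^ (1 + a) := by
      have hone : 1 ≤ Ct * Real.log t ^ a :=
        one_le_mul_of_one_le_of_one_le hCt1 (Real.one_le_rpow hlog1 ha.le)
      rw [div_le_iff₀ hL0, hL', Real.rpow_add ht0, Real.rpow_one]
      have : t * t ^ a * (Ct * Real.log t ^ a / t ^ a) = t * (Ct * Real.log t ^ a) := by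
        field_simp
      rw [this]
      exact le_mul_of_one_le_right ht0.le hone
    have h2 := Real.log_le_log (by positivity) h1
    rw [Real.log_rpow ht0] at h2
    linarith
  have hmain : (t / L) ^ (1 / (1 + a)) * Real.log (t / L) ^ (a / (1 + a)) ≤ t / (6 * C) := by
    calc (t / L) ^ (1 / (1 + a)) * Real.log (t / L) ^ (a / (1 + a))
        ≤ (t / L) ^ (1 / (1 + a)) * ((2 + a) * Real.log t) ^ (a / (1 + a)) := by gcongr
      _ = (t / L * ((2 + a) * Real.log t) ^ a) ^ (1 / (1 + a)) := by
          rw [Real.mul_rpow (x := t / L) (by positivity) (by positivity),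
            ← Real.rpow_mul (by positivity : 0 ≤ (2 + a) * Real.log t), mul_one_div]
      _ ≤ ((t / (6 * C)) ^ (1 + a)) ^ (1 / (1 + a)) := by
          refine Real.rpow_le_rpow (by positivity) ?_ (by positivity)
          have hCa : 0 < (6 * C) ^ (1 + a) := by positivity
          rw [Real.div_rpow ht0.le (by positivity), Real.mul_rpow (by positivity) hlog0.le,
            le_div_iff₀ hCa, hL', Real.rpow_add ht0, Real.rpow_one]
          have : t / (Ct * Real.log t ^ a / t ^ a) * ((2 + a) ^ a * Real.log t ^ a) *
              (6 * C) ^ (1 + a) = t * t ^ a * (((2 + a) ^ a * (6 * C) ^ (1 + a)) / Ct) := by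
            field_simp
          rw [this]
          exact mul_le_of_le_one_right (by positivity) ((div_le_one hCt0).2 hCt)
      _ = t / (6 * C) := by
          rw [← Real.rpow_mul (by positivity), mul_one_div_cancel (by positivity), Real.rpow_one]
  calc C * (t / L) ^ (1 / (1 + a)) * Real.log (t / L) ^ (a / (1 + a))
      = C * ((t / L) ^ (1 / (1 + a)) * Real.log (t / L) ^ (a / (1 + a))) := by ring
    _ ≤ C * (t / (6 * C)) := by gcongr
    _ = t / 6 := by field_simp

/-- Constant cumulative posterior standard deviation under a Matérn-type
information-gain bound, case d < ν. -/
theorem sum_postStd_matern_d_lt_nu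
{X : Type*} [Nonempty X] (k : X → X → ℝ)
    (hsym : ∀ x y : X, k x y = k y x)
    (hpsd : ∀ (n : ℕ) (xv : Fin n → X) (c : Fin n → ℝ),
      0 ≤ ∑ i, ∑ j, c i * c j * k (xv i) (xv j))
    (hk1 : ∀ x : X, k x x ≤ 1)
    (CMat lamBar : ℝ) (hCMat : 0 < CMat) (hlamBar : 0 < lamBar)
    (T0 : ℕ) (hT0 : 2 ≤ T0) (d : ℕ) (hd : 1 ≤ d) (ν : ℝ) (hν : 0 < ν)
    (hgain : ∀ lam : ℝ, 0 < lam → lam ≤ lamBar → ∀ t : ℕ, T0 ≤ t →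
      mig k t lam ≤ ENNReal.ofReal
        (CMat * ((t : ℝ) / lam ^ 2) ^ ((d : ℝ) / (2 * ν + (d : ℝ))) *
          Real.log ((t : ℝ) / lam ^ 2) ^ (2 * ν / (2 * ν + (d : ℝ)))))
    (Ctil : ℝ) (hCtil : Ctil = max 1
      ((2 + 2 * ν / (d : ℝ)) ^ (2 * ν / (d : ℝ)) * (6 * CMat) ^ (1 + 2 * ν / (d : ℝ))))
    (Tlam : ℕ) (hTlam : ∀ t : ℕ, Tlam ≤ t →
      Ctil * (t : ℝ) ^ (-(2 * ν / (d : ℝ))) * Real.log (t : ℝ) ^ (2 * ν / (d : ℝ)) ≤ lamBar ^ 2)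
    (TMat : ℕ) (hTMat : TMat = max 4 (max T0 Tlam))
    (hdν : (d : ℝ) < ν) :
    ∀ T : ℕ, 0 < T → ∀ xs : Fin T → X,
      ∑ t : Fin T, postStd k (pre xs t) (xs t) ≤
        (TMat : ℝ) + Real.sqrt Ctil * Real.Gamma (ν / (d : ℝ) + 1) /
          (ν / (d : ℝ) - 1) ^ (ν / (d : ℝ) + 1) := by
  intro T _ xs
  have hd0 : (0 : ℝ) < d := by exact_mod_cast hd
  set p : ℝ := ν / d with hp_def
  have hp : 1 < p := (one_lt_div hd0).2 hdν
  have ha : 2 * ν / (d : ℝ) = 2 * p := by rw [hp_def]; ring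
  have hexp₁ : (d : ℝ) / (2 * ν + d) = 1 / (1 + 2 * p) := by
    rw [hp_def]; field_simp; ring
  have hexp₂ : 2 * ν / (2 * ν + (d : ℝ)) = 2 * p / (1 + 2 * p) := by
    rw [hp_def]; field_simp; ring
  simp only [ha, hexp₁, hexp₂] at hgain hCtil hTlam
  have hCtil1 : 1 ≤ Ctil := hCtil ▸ le_max_left _ _
  have hCtil2 : (2 + 2 * p) ^ (2 * p) * (6 * CMat) ^ (1 + 2 * p) ≤ Ctil := hCtil ▸ le_max_right _ _
  have hT4 : 4 ≤ TMat := hTMat ▸ le_max_left _ _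
  have hT0' : T0 ≤ TMat := hTMat ▸ (le_max_left _ _).trans (le_max_right _ _)
  have hTlam' : Tlam ≤ TMat := hTMat ▸ (le_max_right _ _).trans (le_max_right _ _)
  set B : ℝ := Real.Gamma (p + 1) / (p - 1) ^ (p + 1) with hB
  have hB0 : 0 ≤ B := div_nonneg (Real.Gamma_pos_of_pos (by linarith)).le
    (Real.rpow_nonneg (by linarith) _)
  let h : ℕ → ℝ := fun m => Real.sqrt Ctil * (Real.log (m : ℝ) / m) ^ p
  let g : ℕ → ℝ := fun m => if m ≤ TMat then 1 else h m
  have hone : ∀ t : Fin T, postStd k (pre xs t) (xs t) ≤ 1 := fun t =>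
    postStd_le_one hsym hpsd hk1 _ _
  have hex : ∀ S : Finset (Fin T), S.Nonempty →
      ∃ t ∈ S, postStd k (pre xs t) (xs t) ≤ g S.card := by
    rintro S ⟨t₀, ht₀⟩
    by_cases hm : S.card ≤ TMat
    · exact ⟨t₀, ht₀, by simpa only [g, if_pos hm] using hone t₀⟩
    simp only [g, if_neg hm]
    set m := S.card with hm_def
    have hm3 : (3 : ℝ) ≤ m := by exact_mod_cast (by omega : 3 ≤ m)
    have hm0 : (0 : ℝ) < m := by linarith
    have hlogm : 0 < Real.log (m : ℝ) := Real.log_pos (by linarith)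
    have hh0 : 0 < h m := by
      have : 0 < Real.sqrt Ctil := Real.sqrt_pos.2 (by linarith)
      simp only [h]
      positivity
    have hsq : h m ^ 2 = Ctil * (m : ℝ) ^ (-(2 * p)) * Real.log (m : ℝ) ^ (2 * p) := by
      simp only [h]
      rw [mul_pow, Real.sq_sqrt (by linarith), ← Real.rpow_mul_natCast (by positivity),
        Real.div_rpow hlogm.le hm0.le, Real.rpow_neg hm0.le, Nat.cast_ofNat, mul_comm p 2]
      ring
    by_cases hh1 : 1 ≤ h m
    · exact ⟨t₀, ht₀, (hone t₀).trans hh1⟩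
    have hle : h m ≤ lamBar := by
      refine le_of_sq_le_sq ?_ hlamBar.le
      rw [hsq]
      exact hTlam m (by omega)
    have hgm := hgain (h m) hh0 hle m (by omega)
    have hgain6 := matern_gain_le hCMat (by linarith : 0 < 2 * p) hm3 hCtil1 hCtil2 hsq
      (by nlinarith)
    refine exists_postStd_le hsym hpsd xs S hh0 (hgm.trans_lt ?_)
    rw [ENNReal.ofReal_lt_ofReal_iff (by have := Real.log_two_gt_d9; positivity)]
    refine hgain6.trans_lt ?_
    have := Real.log_two_gt_d9
    nlinarith
  have hsum := sum_le_sum_range_of_exists_le _ g hex Finset.univ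
  rw [Finset.card_univ, Fintype.card_fin] at hsum
  rw [mul_div_assoc, ← hB]
  refine hsum.trans ?_
  have hsB : 0 ≤ Real.sqrt Ctil * B := by positivity
  have hfirst : ∀ n ≤ TMat, ∑ i ∈ Finset.range n, g (i + 1) = n := by
    intro n hn
    rw [Finset.sum_congr rfl (g := fun _ => (1 : ℝ))]
    · simp
    · intro i hi
      have := Finset.mem_range.1 hi
      exact if_pos (by omega)
  rcases le_total T TMat with hT | hT
  · rw [hfirst T hT]
    have : (T : ℝ) ≤ TMat := by exact_mod_cast hT
    linarith
  · obtain ⟨n, rfl⟩ := Nat.exists_eq_add_of_le hT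
    rw [Finset.sum_range_add, hfirst TMat le_rfl]
    refine add_le_add le_rfl ?_
    calc ∑ i ∈ Finset.range n, g (TMat + i + 1)
        = ∑ i ∈ Finset.range n, Real.sqrt Ctil *
            (Real.log ((TMat + (i + 1) : ℕ) : ℝ) / ((TMat + (i + 1) : ℕ) : ℝ)) ^ p :=
          Finset.sum_congr rfl fun i _ => if_neg (by omega)
      _ ≤ Real.sqrt Ctil * B := by
          rw [← Finset.mul_sum]
          exact mul_le_mul_of_nonneg_left (sum_log_div_self_rpow_le hp (by omega) n)
            (Real.sqrt_nonneg _)
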